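/- arXiv:1503.04285 — 9 statements merged into one kernel-verified Lean document; each statement's English description precedes it below -/
import Mathlib

section
/- For every integer n ≥ 0, the function ν ↦ 1/b_{2n+1}(ν) = Γ(ν+1)/(2^{2n+1} n! (ν+1) Γ(n+ν+2)) is log-convex on (0,∞); equivalently, the function ν ↦ log Γ(ν+1) − log(ν+1) − log Γ(n+ν+2) is convex on (0,∞). -/
theorem aux_neg_log (c : ℝ) (hc : 0 < c) :
    ConvexOn ℝ (Set.Ioi (0 : ℝ)) (fun ν : ℝ => - Real.log (ν + c)) := by
  refine ⟨convex_Ioi 0, ?_⟩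
  intro x hx y hy a b ha hb hab
  have hx' : 0 < x := hx
  have hy' : 0 < y := hy
  have h := strictConcaveOn_log_Ioi.concaveOn.2 (x := x + c) (y := y + c)
    (Set.mem_Ioi.2 (by linarith)) (Set.mem_Ioi.2 (by linarith)) ha hb hab
  simp only [smul_eq_mul] at h ⊢
  have e : a * (x + c) + b * (y + c) = a * x + b * y + c := by
    linear_combination c * hab
  rw [e] at h
  linarith

theorem aux_conv (n : ℕ) :
    ConvexOn ℝ (Set.Ioi (0 : ℝ)) (fun ν : ℝ =>
      Real.log (Real.Gamma (ν + 1)) - Real.log (ν + 1) - Real.log (Real.Gamma (n + ν + 2))) := by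
  induction n with
  | zero =>
    refine ((aux_neg_log 1 one_pos).add (aux_neg_log 1 one_pos)).congr ?_
    intro ν hν
    have hν' : 0 < ν := hν
    have e : ((0 : ℕ) : ℝ) + ν + 2 = (ν + 1) + 1 := by push_cast; ring
    simp only [Pi.add_apply]
    rw [e, Real.Gamma_add_one (s := ν + 1) (by positivity),
      Real.log_mul (x := ν + 1) (by positivity) (Real.Gamma_pos_of_pos (by positivity)).ne']
    ring
  | succ n ih =>
    refine (ih.add (aux_neg_log (n + 2) (by positivity))).congr ?_
    intro ν hν
    have hν' : 0 < ν := hν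
    have e : ((n + 1 : ℕ) : ℝ) + ν + 2 = (n + ν + 2) + 1 := by push_cast; ring
    simp only [Pi.add_apply]
    rw [e, Real.Gamma_add_one (s := n + ν + 2) (by positivity),
      Real.log_mul (x := n + ν + 2) (by positivity) (Real.Gamma_pos_of_pos (by positivity)).ne',
      show ν + ((n : ℝ) + 2) = n + ν + 2 by ring]
    ring

/-- For every integer `n ≥ 0`, the function
`ν ↦ 1/b_{2n+1}(ν) = Γ(ν+1)/(2^{2n+1} n! (ν+1) Γ(n+ν+2))` is log-convex on `(0,∞)`,
i.e. its logarithm is convex on `(0,∞)`. -/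
theorem logConvex_one_div_bOdd (n : ℕ) :
    ConvexOn ℝ (Set.Ioi (0 : ℝ)) (fun ν : ℝ =>
      Real.log (Real.Gamma (ν + 1) /
        (2 ^ (2 * n + 1) * (Nat.factorial n) * (ν + 1) * Real.Gamma (n + ν + 2)))) := by
  refine ((aux_conv n).add_const (-Real.log (2 ^ (2 * n + 1) * (Nat.factorial n)))).congr ?_
  intro ν hν
  have hν' : 0 < ν := hν
  have h1 : 0 < Real.Gamma (ν + 1) := Real.Gamma_pos_of_pos (by positivity)
  have h2 : 0 < Real.Gamma (n + ν + 2) := Real.Gamma_pos_of_pos (by positivity)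
  have h3 : (0 : ℝ) < 2 ^ (2 * n + 1) * (Nat.factorial n) := by positivity
  have h4 : (0 : ℝ) < ν + 1 := by positivity
  simp only [Pi.add_apply]
  rw [Real.log_div h1.ne' (by positivity), Real.log_mul (by positivity) h2.ne',
    Real.log_mul h3.ne' h4.ne']
  ring
end

section
/- For fixed λ ≥ 0 and x ≥ 0, the function ν ↦ E_ν(λ,x) is log-convex on (0,∞): for all ν₁, ν₂ > 0 and all α ∈ [0,1], E_{αν₁+(1−α)ν₂}(λ,x) ≤ [E_{ν₁}(λ,x)]^α · [E_{ν₂}(λ,x)]^{1−α}. -/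
open Real

/-- `b_n(ν)` from the series expansion of the Dunkl kernel:
`b_{2n}(ν) = 2^{2n} n! Γ(n+ν+1)/Γ(ν+1)` and `b_{2n+1}(ν) = 2(ν+1) b_{2n}(ν+1)`. -/
noncomputable def dunklB (n : ℕ) (ν : ℝ) : ℝ :=
  if Even n then
    2 ^ n * (Nat.factorial (n / 2)) * Real.Gamma ((n / 2 : ℕ) + ν + 1) / Real.Gamma (ν + 1)
  else
    2 * (ν + 1) *
      (2 ^ (n - 1) * (Nat.factorial (n / 2)) * Real.Gamma ((n / 2 : ℕ) + (ν + 1) + 1) /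
        Real.Gamma ((ν + 1) + 1))

/-- The Dunkl kernel `E_ν(λ, x) = Σ_{n=0}^∞ (λ x)^n / b_n(ν)`. -/
noncomputable def dunklE (ν lam x : ℝ) : ℝ :=
  ∑' n : ℕ, (lam * x) ^ n / dunklB n ν

/-- The normalized Dunkl kernel `Ẽ_ν(λ,x) = ∫_{-1}^1 e^{λxt}(1-t²)^{ν-1}(1+t) dt`. -/
noncomputable def dunklEt (ν lam x : ℝ) : ℝ :=
  ∫ t in (-1 : ℝ)..1, Real.exp (lam * x * t) * (1 - t ^ 2) ^ (ν - 1) * (1 + t)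


lemma dunklB_eq_prod (ν : ℝ) (hν : 0 < ν) (n : ℕ) :
    dunklB n ν = ∏ k ∈ Finset.range n, ((k:ℝ) + 1 + (if Even k then 2 * ν + 1 else 0)) := by
  have key : ∀ m : ℕ, dunklB (2*m) ν = ∏ k ∈ Finset.range (2*m), ((k:ℝ) + 1 + (if Even k then 2 * ν + 1 else 0))
      ∧ dunklB (2*m+1) ν = ∏ k ∈ Finset.range (2*m+1), ((k:ℝ) + 1 + (if Even k then 2 * ν + 1 else 0)) := by
    have hG : Real.Gamma (ν + 1) ≠ 0 := (Real.Gamma_pos_of_pos (by linarith)).ne'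
    have hodd : ∀ m : ℕ, dunklB (2*m+1) ν = dunklB (2*m) ν * (2 * m + 1 + (2*ν+1)) := by
      intro m
      have h1 : (2*m+1)/2 = m := by omega
      have h2 : (2*m)/2 = m := by omega
      have e2 : (m:ℝ) + (ν+1) + 1 = (m + ν + 1) + 1 := by ring
      have hp : (m:ℝ) + ν + 1 ≠ 0 := by positivity
      have hq : ν + 1 ≠ 0 := by positivity
      have he : ¬ Even (2*m+1) := by simp
      have he' : Even (2*m) := by simp
      rw [dunklB, dunklB, if_neg he, if_pos he', h1, h2, e2, Real.Gamma_add_one hp, Real.Gamma_add_one hq]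
      simp only [Nat.add_sub_cancel]
      field_simp
      ring
    have heven : ∀ m : ℕ, dunklB (2*(m+1)) ν = dunklB (2*m+1) ν * ((2*m+1:ℕ) + 1 + 0) := by
      intro m
      rw [hodd]
      have h1 : (2*(m+1))/2 = m+1 := by omega
      have h2 : (2*m)/2 = m := by omega
      have e2 : ((m+1:ℕ):ℝ) + ν + 1 = (m + ν + 1) + 1 := by push_cast; ring
      have hp : (m:ℝ) + ν + 1 ≠ 0 := by positivity
      have he : Even (2*(m+1)) := by simp
      have he' : Even (2*m) := by simp
      rw [dunklB, dunklB, if_pos he, if_pos he', h1, h2, e2, Real.Gamma_add_one hp, Nat.factorial_succ]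
      push_cast
      field_simp
      ring
    intro m
    have h0 : dunklB (2*m) ν = ∏ k ∈ Finset.range (2*m), ((k:ℝ) + 1 + (if Even k then 2 * ν + 1 else 0)) := by
      induction m with
      | zero => simp [dunklB, hG]
      | succ m ih =>
        rw [heven, hodd, ih, show 2*(m+1) = 2*m+1+1 by ring, Finset.prod_range_succ, Finset.prod_range_succ]
        simp
    refine ⟨h0, ?_⟩
    rw [hodd, h0, Finset.prod_range_succ]
    simp
  rcases Nat.even_or_odd' n with ⟨m, rfl | rfl⟩
  · exact (key m).1
  · exact (key m).2

lemma dunklB_ge (ν : ℝ) (hν : 0 < ν) (n : ℕ) : (n.factorial : ℝ) ≤ dunklB n ν := by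
  rw [dunklB_eq_prod ν hν, ← Finset.prod_range_add_one_eq_factorial]
  push_cast
  apply Finset.prod_le_prod
  · intros; positivity
  · intros; split_ifs <;> linarith

lemma dunklB_pos (ν : ℝ) (hν : 0 < ν) (n : ℕ) : 0 < dunklB n ν :=
  lt_of_lt_of_le (by positivity) (dunklB_ge ν hν n)

lemma dunkl_summable (ν z : ℝ) (hν : 0 < ν) (hz : 0 ≤ z) :
    Summable (fun n : ℕ => z ^ n / dunklB n ν) := by
  refine Summable.of_nonneg_of_le (fun n => ?_) (fun n => ?_) (Real.summable_pow_div_factorial z)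
  · have := dunklB_pos ν hν n
    positivity
  · have := dunklB_ge ν hν n
    gcongr

lemma dunklB_logConcave (a b s t : ℝ) (ha : 0 < a) (hb : 0 < b) (hs : 0 < s) (ht : 0 < t)
    (hst : s + t = 1) (n : ℕ) :
    dunklB n a ^ s * dunklB n b ^ t ≤ dunklB n (s * a + t * b) := by
  have hc : 0 < s * a + t * b := by positivity
  rw [dunklB_eq_prod a ha, dunklB_eq_prod b hb, dunklB_eq_prod _ hc]
  have hnn : ∀ c : ℝ, 0 < c → ∀ k : ℕ, 0 ≤ ((k:ℝ) + 1 + (if Even k then 2 * c + 1 else 0)) := by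
    intro c hc k
    split_ifs <;> positivity
  rw [← Real.finsetProd_rpow _ _ (fun i _ => hnn a ha i),
    ← Real.finsetProd_rpow _ _ (fun i _ => hnn b hb i), ← Finset.prod_mul_distrib]
  apply Finset.prod_le_prod
  · intro k _
    have := hnn a ha k
    have := hnn b hb k
    positivity
  · intro k _
    refine (Real.geom_mean_le_arith_mean2_weighted hs.le ht.le (hnn a ha k) (hnn b hb k) hst).trans
      (le_of_eq ?_)
    obtain rfl : t = 1 - s := by linarith
    split_ifs <;> ring

/-- for fixed `λ ≥ 0`, `x ≥ 0`, the function `ν ↦ E_ν(λ,x)` is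
log-convex on `(0,∞)`. -/
theorem dunklE_logConvex (lam x : ℝ) (hlam : 0 ≤ lam) (hx : 0 ≤ x) :
    ∀ ν₁ ν₂ α : ℝ, 0 < ν₁ → 0 < ν₂ → α ∈ Set.Icc (0 : ℝ) 1 →
      dunklE (α * ν₁ + (1 - α) * ν₂) lam x ≤
        dunklE ν₁ lam x ^ α * dunklE ν₂ lam x ^ (1 - α) := by
  intro a b s ha hb hs
  rcases hs.1.eq_or_lt with h0 | h0
  · subst h0; simp
  rcases hs.2.eq_or_lt with h1 | h1
  · subst h1; simp
  have ht : 0 < 1 - s := by linarith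
  have hc : 0 < s * a + (1 - s) * b := by positivity
  have hz : 0 ≤ lam * x := by positivity
  unfold dunklE
  set z := lam * x
  have hA : ∀ c : ℝ, 0 < c → ∀ n, 0 ≤ z ^ n / dunklB n c := fun c hc n => by
    have := dunklB_pos c hc n
    positivity
  have hpq : (1 / s).HolderConjugate (1 / (1 - s)) := by
    rw [Real.holderConjugate_iff]
    refine ⟨by rw [lt_div_iff₀ h0]; linarith, by simp⟩
  have ep : ∀ c : ℝ, 0 < c → ∀ r : ℝ, 0 < r → ∀ n,
      ((z ^ n / dunklB n c) ^ r) ^ (1 / r) = z ^ n / dunklB n c := by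
    intro c hc r hr n
    rw [← Real.rpow_mul (hA c hc n), mul_one_div_cancel hr.ne', Real.rpow_one]
  have H := Real.summable_and_inner_le_Lp_mul_Lq_tsum_of_nonneg hpq
    (f := fun n => (z ^ n / dunklB n a) ^ s) (g := fun n => (z ^ n / dunklB n b) ^ (1 - s))
    (fun n => Real.rpow_nonneg (hA a ha n) _) (fun n => Real.rpow_nonneg (hA b hb n) _)
    (by simp only [ep a ha s h0]; exact dunkl_summable a z ha hz)
    (by simp only [ep b hb (1 - s) ht]; exact dunkl_summable b z hb hz)
  simp only [ep a ha s h0, ep b hb (1 - s) ht, one_div_one_div] at H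
  refine le_trans ((dunkl_summable _ z hc hz).tsum_le_tsum (fun n => ?_) H.1) H.2
  have pa := dunklB_pos a ha n
  have pb := dunklB_pos b hb n
  have hzn : 0 ≤ z ^ n := by positivity
  rw [Real.div_rpow hzn pa.le, Real.div_rpow hzn pb.le, div_mul_div_comm,
    ← Real.rpow_add_of_nonneg hzn h0.le ht.le, add_sub_cancel, Real.rpow_one]
  have := dunklB_logConcave a b s (1 - s) ha hb h0 ht (by ring) n
  gcongr
end

section
/- For all λ ≥ 0, x ≥ 0 and ν > 0, the Turán type inequality [E_{ν+1}(λ,x)]² ≤ E_ν(λ,x) · E_{ν+2}(λ,x) holds. -/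
open Real

lemma dB_gamma (s : ℝ) (hs : 0 < s) (n : ℕ) :
    Real.Gamma (n + s) = (∏ i ∈ Finset.range n, (s + i)) * Real.Gamma s := by
  induction n with
  | zero => simp
  | succ n ih =>
    rw [Finset.prod_range_succ]
    have h : ((n + 1 : ℕ) : ℝ) + s = (n + s) + 1 := by push_cast; ring
    rw [h, Real.Gamma_add_one (by positivity), ih]
    ring

lemma dB_eq (n : ℕ) (ν : ℝ) (hν : 0 < ν) :
    dunklB n ν = 2 ^ n * (Nat.factorial (n / 2)) *
      ∏ i ∈ Finset.range ((n + 1) / 2), (ν + 1 + i) := by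
  unfold dunklB
  split_ifs with h
  · have h2 : (n + 1) / 2 = n / 2 := by
      obtain ⟨k, rfl⟩ := h; omega
    have hg : Real.Gamma (ν + 1) ≠ 0 := (Real.Gamma_pos_of_pos (by positivity)).ne'
    rw [h2, add_assoc, dB_gamma (ν + 1) (by positivity)]
    field_simp
  · have hodd := Nat.not_even_iff_odd.mp h
    have h2 : (n + 1) / 2 = n / 2 + 1 := by
      obtain ⟨k, rfl⟩ := hodd; omega
    have hg : Real.Gamma (ν + 1 + 1) ≠ 0 := (Real.Gamma_pos_of_pos (by positivity)).ne'
    have hp : (2 : ℝ) ^ n = 2 ^ (n - 1) * 2 := by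
      rw [← pow_succ]; congr 1; obtain ⟨k, rfl⟩ := hodd; omega
    rw [h2, add_assoc, dB_gamma (ν + 1 + 1) (by positivity), Finset.prod_range_succ', hp]
    have : ∀ i : ℕ, ν + 1 + ((i + 1 : ℕ) : ℝ) = ν + 1 + 1 + i := by intro i; push_cast; ring
    simp only [this]
    field_simp
    simp

lemma dB_ge (n : ℕ) (ν : ℝ) (hν : 0 < ν) : (n.factorial : ℝ) ≤ dunklB n ν := by
  rw [dB_eq n ν hν]
  have h1 : (((n + 1) / 2).factorial : ℝ) ≤ ∏ i ∈ Finset.range ((n + 1) / 2), (ν + 1 + i) := by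
    rw [← Finset.prod_range_add_one_eq_factorial]
    push_cast
    apply Finset.prod_le_prod
    · intro i _; positivity
    · intro i _; linarith
  have h2 : n.factorial ≤ 2 ^ n * (n / 2).factorial * ((n + 1) / 2).factorial := by
    have h3 := Nat.choose_mul_factorial_mul_factorial (Nat.div_le_self n 2)
    have h4 : n - n / 2 = (n + 1) / 2 := by omega
    rw [h4] at h3
    rw [← h3]
    gcongr
    exact Nat.choose_le_two_pow _ _
  have h2' : (n.factorial : ℝ) ≤ 2 ^ n * (n / 2).factorial * ((n + 1) / 2).factorial := by
    exact_mod_cast h2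
  exact h2'.trans (by gcongr)

lemma dB_pos (n : ℕ) (ν : ℝ) (hν : 0 < ν) : 0 < dunklB n ν :=
  lt_of_lt_of_le (by positivity) (dB_ge n ν hν)

lemma dB_mul (n : ℕ) (ν : ℝ) (hν : 0 < ν) :
    dunklB n ν * dunklB n (ν + 2) ≤ dunklB n (ν + 1) ^ 2 := by
  rw [dB_eq n ν hν, dB_eq n (ν + 1) (by positivity), dB_eq n (ν + 2) (by positivity)]
  have h : (∏ i ∈ Finset.range ((n + 1) / 2), (ν + 1 + i)) *
      (∏ i ∈ Finset.range ((n + 1) / 2), (ν + 2 + 1 + i)) ≤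
      (∏ i ∈ Finset.range ((n + 1) / 2), (ν + 1 + 1 + i)) ^ 2 := by
    rw [← Finset.prod_mul_distrib, ← Finset.prod_pow]
    apply Finset.prod_le_prod
    · intro i _; positivity
    · intro i _; nlinarith
  have h5 := mul_le_mul_of_nonneg_left h
    (sq_nonneg ((2 : ℝ) ^ n * (Nat.factorial (n / 2))))
  linarith

lemma dB_summable (ν y : ℝ) (hν : 0 < ν) (hy : 0 ≤ y) :
    Summable fun n : ℕ => y ^ n / dunklB n ν := by
  refine Summable.of_nonneg_of_le (fun n => ?_) (fun n => ?_) (Real.summable_pow_div_factorial y)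
  · have := dB_pos n ν hν
    positivity
  · have := dB_ge n ν hν
    gcongr

/-- Turán type inequality for the Dunkl kernel. -/
theorem dunklE_turan (lam x ν : ℝ) (hlam : 0 ≤ lam) (hx : 0 ≤ x) (hν : 0 < ν) :
    dunklE (ν + 1) lam x ^ 2 ≤ dunklE ν lam x * dunklE (ν + 2) lam x := by
  have hy : 0 ≤ lam * x := mul_nonneg hlam hx
  unfold dunklE
  generalize lam * x = y at hy
  have s0 := (dB_summable ν y hν hy).hasSum.tendsto_sum_nat
  have s1 := (dB_summable (ν + 1) y (by positivity) hy).hasSum.tendsto_sum_nat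
  have s2 := (dB_summable (ν + 2) y (by positivity) hy).hasSum.tendsto_sum_nat
  refine le_of_tendsto_of_tendsto' (s1.pow 2) (s0.mul s2) (fun N => ?_)
  apply Finset.sum_sq_le_sum_mul_sum_of_sq_le_mul
  · intro n _
    have := dB_pos n ν hν
    positivity
  · intro n _
    have := dB_pos n (ν + 2) (by positivity)
    positivity
  · intro n _
    have h0 := dB_pos n ν hν
    have h2 := dB_pos n (ν + 2) (by positivity)
    have h := dB_mul n ν hν
    rw [div_pow, div_mul_div_comm, ← sq]
    gcongr
end

section
/- For fixed λ, x ∈ ℝ, the function ν ↦ Ẽ_ν(λ,x) = ∫_{-1}^{1} e^{λxt} (1−t²)^{ν−1} (1+t) dt is log-convex on (0,∞): for all ν₁, ν₂ > 0 and all α ∈ [0,1], Ẽ_{αν₁+(1−α)ν₂}(λ,x) ≤ [Ẽ_{ν₁}(λ,x)]^α · [Ẽ_{ν₂}(λ,x)]^{1−α}. -/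
open Real

open MeasureTheory in
lemma dunkl_aux_integrable (lam x ν : ℝ) (hν : 0 < ν) :
    IntegrableOn (fun t : ℝ => Real.exp (lam * x * t) * (1 - t ^ 2) ^ (ν - 1) * (1 + t))
      (Set.Ioo (-1) 1) := by
  have hA : IntervalIntegrable (fun t : ℝ => t ^ (ν - 1)) volume 0 1 :=
    intervalIntegral.intervalIntegrable_rpow' (by linarith)
  have h1 : IntervalIntegrable (fun t : ℝ => (1 + t) ^ (ν - 1)) volume (-1) 0 := by
    have := hA.comp_add_left 1
    simpa using this
  have h2 : IntervalIntegrable (fun t : ℝ => (1 - t) ^ (ν - 1)) volume 0 1 := by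
    have := (hA.comp_sub_left 1).symm
    simpa using this
  have k1 : IntervalIntegrable (fun t : ℝ => (1 + t) ^ (ν - 1) *
      ((1 - t) ^ (ν - 1) * Real.exp (lam * x * t) * (1 + t))) volume (-1) 0 := by
    apply h1.mul_continuousOn
    rw [Set.uIcc_of_le (by norm_num)]
    refine ContinuousOn.mul (ContinuousOn.mul ?_ (by fun_prop)) (by fun_prop)
    refine ContinuousOn.rpow_const (by fun_prop) ?_
    intro t ht
    left
    have := ht.2
    linarith
  have k2 : IntervalIntegrable (fun t : ℝ => (1 - t) ^ (ν - 1) *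
      ((1 + t) ^ (ν - 1) * Real.exp (lam * x * t) * (1 + t))) volume 0 1 := by
    apply h2.mul_continuousOn
    rw [Set.uIcc_of_le (by norm_num)]
    refine ContinuousOn.mul (ContinuousOn.mul ?_ (by fun_prop)) (by fun_prop)
    refine ContinuousOn.rpow_const (by fun_prop) ?_
    intro t ht
    left
    have := ht.1
    linarith
  have k3 : IntervalIntegrable (fun t : ℝ => (1 + t) ^ (ν - 1) *
      ((1 - t) ^ (ν - 1) * Real.exp (lam * x * t) * (1 + t))) volume 0 1 := by
    convert k2 using 2
    ring
  have k := (k1.trans k3)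
  rw [intervalIntegrable_iff_integrableOn_Ioo_of_le (by norm_num)] at k
  refine k.congr_fun ?_ measurableSet_Ioo
  intro t ht
  have e : (1 - t ^ 2 : ℝ) = (1 + t) * (1 - t) := by ring
  simp only
  rw [e, Real.mul_rpow (by linarith [ht.1]) (by linarith [ht.2])]
  ring

open MeasureTheory in
theorem dunklEt_logConvex (lam x : ℝ) :
    ∀ ν₁ ν₂ α : ℝ, 0 < ν₁ → 0 < ν₂ → α ∈ Set.Icc (0 : ℝ) 1 →
      dunklEt (α * ν₁ + (1 - α) * ν₂) lam x ≤
        dunklEt ν₁ lam x ^ α * dunklEt ν₂ lam x ^ (1 - α) := by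
  intro ν₁ ν₂ α h1 h2 hα
  rcases eq_or_lt_of_le hα.1 with h0 | h0
  · subst h0; simp
  rcases eq_or_lt_of_le hα.2 with h3 | h3
  · subst h3; simp
  have hβ : 0 < 1 - α := by linarith
  have hW : ∀ ν, dunklEt ν lam x = ∫ t in Set.Ioo (-1 : ℝ) 1,
      Real.exp (lam * x * t) * (1 - t ^ 2) ^ (ν - 1) * (1 + t) := fun ν => by
    rw [dunklEt, intervalIntegral.integral_of_le (by norm_num), integral_Ioc_eq_integral_Ioo]
  have hpos : ∀ ν : ℝ, ∀ t ∈ Set.Ioo (-1 : ℝ) 1,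
      0 < Real.exp (lam * x * t) * (1 - t ^ 2) ^ (ν - 1) * (1 + t) := by
    intro ν t ht
    have a1 : 0 < 1 + t := by linarith [ht.1]
    have a2 : 0 < 1 - t ^ 2 := by nlinarith [ht.1, ht.2]
    positivity
  have hM : ∀ ν β : ℝ, 0 < ν → 0 < β → MemLp (fun t : ℝ =>
      (Real.exp (lam * x * t) * (1 - t ^ 2) ^ (ν - 1) * (1 + t)) ^ β) (ENNReal.ofReal (1 / β))
      (volume.restrict (Set.Ioo (-1) 1)) := by
    intro ν β hν hb
    have hm : Measurable (fun t : ℝ =>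
      (Real.exp (lam * x * t) * (1 - t ^ 2) ^ (ν - 1) * (1 + t)) ^ β) := by fun_prop
    have hb' : 0 < 1 / β := by positivity
    rw [← integrable_norm_rpow_iff hm.aestronglyMeasurable (by simpa using hb) (by simp),
      ENNReal.toReal_ofReal hb'.le]
    refine IntegrableOn.congr_fun (dunkl_aux_integrable lam x ν hν) ?_ measurableSet_Ioo
    intro t ht
    have := hpos ν t ht
    simp only
    rw [Real.norm_of_nonneg (by positivity), ← Real.rpow_mul this.le, mul_one_div_cancel hb.ne',
      Real.rpow_one]
  have hpq : (1 / α).HolderConjugate (1 / (1 - α)) := by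
    rw [Real.holderConjugate_iff]
    refine ⟨by rw [lt_div_iff₀ h0]; linarith, by simp⟩
  have key := integral_mul_le_Lp_mul_Lq_of_nonneg hpq
    ((ae_restrict_iff' measurableSet_Ioo).2 (Filter.Eventually.of_forall
      fun t ht => (Real.rpow_nonneg (hpos ν₁ t ht).le α)))
    ((ae_restrict_iff' measurableSet_Ioo).2 (Filter.Eventually.of_forall
      fun t ht => (Real.rpow_nonneg (hpos ν₂ t ht).le (1 - α))))
    (hM ν₁ α h1 h0) (hM ν₂ (1 - α) h2 hβ)
  have hback : ∀ ν β : ℝ, 0 < β → ∫ t in Set.Ioo (-1 : ℝ) 1,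
      ((Real.exp (lam * x * t) * (1 - t ^ 2) ^ (ν - 1) * (1 + t)) ^ β) ^ (1 / β)
      = dunklEt ν lam x := by
    intro ν β hb
    rw [hW]
    refine setIntegral_congr_fun measurableSet_Ioo ?_
    intro t ht
    simp only
    rw [← Real.rpow_mul (hpos ν t ht).le, mul_one_div_cancel hb.ne', Real.rpow_one]
  rw [hback _ _ h0, hback _ _ hβ, one_div_one_div, one_div_one_div] at key
  refine le_of_eq_of_le ?_ key
  rw [hW]
  refine setIntegral_congr_fun measurableSet_Ioo ?_
  intro t ht
  have a1 : 0 < 1 + t := by linarith [ht.1]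
  have a2 : 0 < 1 - t ^ 2 := by nlinarith [ht.1, ht.2]
  have a3 := Real.exp_pos (lam * x * t)
  simp only
  rw [Real.mul_rpow (by positivity) a1.le, Real.mul_rpow a3.le (by positivity),
    Real.mul_rpow (by positivity) a1.le, Real.mul_rpow a3.le (by positivity),
    ← Real.rpow_mul a2.le, ← Real.rpow_mul a2.le]
  have s : ∀ y : ℝ, 0 < y → y ^ α * y ^ (1 - α) = y := fun y hy => by
    rw [← Real.rpow_add hy]; simp
  have s2 : (1 - t ^ 2) ^ (α * ν₁ + (1 - α) * ν₂ - 1)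
      = (1 - t ^ 2) ^ ((ν₁ - 1) * α) * (1 - t ^ 2) ^ ((ν₂ - 1) * (1 - α)) := by
    rw [← Real.rpow_add a2]; congr 1; ring
  rw [s2]
  conv_lhs => rw [← s _ a3, ← s _ a1]
  ring
end

section
/- For all λ, x ∈ ℝ and ν > 0, the Turán type inequality [Ẽ_{ν+1}(λ,x)]² ≤ Ẽ_ν(λ,x) · Ẽ_{ν+2}(λ,x) holds. -/
open Real

theorem dunklEt_w_int (c ν : ℝ) (hν : 0 < ν) :
    IntervalIntegrable (fun t : ℝ => Real.exp (c * t) * (1 - t ^ 2) ^ (ν - 1) * (1 + t))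
      MeasureTheory.volume (-1) 1 := by
  have h1 : IntervalIntegrable (fun t : ℝ => (1 - t) ^ (ν - 1)) MeasureTheory.volume (-1) 1 := by
    have h := (intervalIntegral.intervalIntegrable_rpow' (a := 2) (b := 0) (r := ν - 1)
      (by linarith)).comp_sub_left 1
    norm_num at h
    exact h
  have hc : Continuous (fun t : ℝ => Real.exp (c * t) * (1 + t) ^ ν) := by
    refine Continuous.mul (by fun_prop) ?_
    exact Continuous.rpow_const (by fun_prop) (fun _ => Or.inr hν.le)
  have h2 := h1.continuousOn_mul (hc.continuousOn (s := Set.uIcc (-1) 1))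
  refine h2.congr ?_
  intro t ht
  rw [Set.uIoc_of_le (by norm_num)] at ht
  obtain ⟨ha, hb⟩ := ht
  have e : (1 - t ^ 2 : ℝ) = (1 + t) * (1 - t) := by ring
  have e2 : (1 + t) ^ ν = (1 + t) ^ (ν - 1) * (1 + t) := by
    rw [← Real.rpow_add_one' (by linarith) (by linarith)]
    congr 1; ring
  simp only
  rw [e, Real.mul_rpow (by linarith) (by linarith), e2]
  ring

/-- Turán type inequality for the normalized Dunkl kernel. -/
theorem dunklEt_turan (lam x ν : ℝ) (hν : 0 < ν) :
    dunklEt (ν + 1) lam x ^ 2 ≤ dunklEt ν lam x * dunklEt (ν + 2) lam x := by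
  have iA := dunklEt_w_int (lam * x) ν hν
  have iB := dunklEt_w_int (lam * x) (ν + 1) (by linarith)
  have iC := dunklEt_w_int (lam * x) (ν + 2) (by linarith)
  have key : ∀ r : ℝ, 0 ≤ dunklEt ν lam x * (r * r) + (-2 * dunklEt (ν + 1) lam x) * r
      + dunklEt (ν + 2) lam x := by
    intro r
    have e : dunklEt ν lam x * (r * r) + (-2 * dunklEt (ν + 1) lam x) * r
      + dunklEt (ν + 2) lam x = ∫ t in (-1 : ℝ)..1,
        ((r * r) * (Real.exp (lam * x * t) * (1 - t ^ 2) ^ (ν - 1) * (1 + t))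
        + (-2 * r) * (Real.exp (lam * x * t) * (1 - t ^ 2) ^ (ν + 1 - 1) * (1 + t)))
        + Real.exp (lam * x * t) * (1 - t ^ 2) ^ (ν + 2 - 1) * (1 + t) := by
      rw [intervalIntegral.integral_add ((iA.const_mul _).add (iB.const_mul _)) iC,
        intervalIntegral.integral_add (iA.const_mul _) (iB.const_mul _),
        intervalIntegral.integral_const_mul, intervalIntegral.integral_const_mul]
      unfold dunklEt
      ring
    rw [e]
    refine intervalIntegral.integral_nonneg (by norm_num) ?_
    rintro t ⟨ha, hb⟩
    have hs : (0 : ℝ) ≤ 1 - t ^ 2 := by nlinarith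
    have e1 : (1 - t ^ 2) ^ (ν + 1 - 1) = (1 - t ^ 2) ^ (ν - 1) * (1 - t ^ 2) := by
      rw [← Real.rpow_add_one' hs (by linarith)]
      congr 1; ring
    have e2 : (1 - t ^ 2) ^ (ν + 2 - 1) = (1 - t ^ 2) ^ (ν + 1 - 1) * (1 - t ^ 2) := by
      rw [← Real.rpow_add_one' hs (by linarith)]
      congr 1; ring
    rw [e2, e1]
    have h1 : (0 : ℝ) ≤ 1 + t := by linarith
    have h : 0 ≤ (r - (1 - t ^ 2)) ^ 2 *
        (Real.exp (lam * x * t) * (1 - t ^ 2) ^ (ν - 1) * (1 + t)) := by positivity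
    refine h.trans_eq ?_
    ring
  have := discrim_le_zero key
  unfold discrim at this
  nlinarith
end

section
/- Fix q ∈ (0,1) and an integer k ≥ 0. The function ν ↦ Γ_{q²}(ν+1)/Γ_{q²}(ν+k+1) is log-convex on (0,∞); equivalently, ν ↦ log Γ_{q²}(ν+1) − log Γ_{q²}(ν+k+1) is convex on (0,∞). -/
open Real

/-- The `q`-gamma function with base `p ∈ (0,1)`:
`Γ_p(x) = (1-p)^{1-x} ∏_{n=0}^∞ (1-p^{n+1})/(1-p^{n+x})`. -/
noncomputable def qGamma (p x : ℝ) : ℝ :=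
  (1 - p) ^ (1 - x) * ∏' n : ℕ, (1 - p ^ (n + 1)) / (1 - p ^ ((n : ℝ) + x))

/-- `b_k(ν; q²)` from the series expansion of the `q`-Dunkl kernel:
`b_{2k}(ν;q²) = (1+q)^k Γ_{q²}(k+1) Γ_{q²}(ν+k+1)/Γ_{q²}(ν+1)` and
`b_{2k+1}(ν;q²) = (1+q)^{2k+1} Γ_{q²}(k+1) Γ_{q²}(ν+k+2)/Γ_{q²}(ν+1)`. -/
noncomputable def qDunklB (q : ℝ) (n : ℕ) (ν : ℝ) : ℝ :=
  if Even n then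
    (1 + q) ^ (n / 2) * qGamma (q ^ 2) ((n / 2 : ℕ) + 1) *
      qGamma (q ^ 2) (ν + (n / 2 : ℕ) + 1) / qGamma (q ^ 2) (ν + 1)
  else
    (1 + q) ^ n * qGamma (q ^ 2) ((n / 2 : ℕ) + 1) *
      qGamma (q ^ 2) (ν + (n / 2 : ℕ) + 2) / qGamma (q ^ 2) (ν + 1)

/-- The `q`-Dunkl kernel `E_ν(z; q²) = Σ_{k=0}^∞ z^k / b_k(ν; q²)`. -/
noncomputable def qDunklE (q ν z : ℝ) : ℝ :=
  ∑' k : ℕ, z ^ k / qDunklB q k ν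

/-- The infinite `q`-shifted factorial `(a; p)_∞ = ∏_{k=0}^∞ (1 - a p^k)`. -/
noncomputable def qPochInf (a p : ℝ) : ℝ :=
  ∏' k : ℕ, (1 - a * p ^ k)

/-- The weight `W_ν(x; q²) = (x²q²; q²)_∞ / (x²q^{2ν+1}; q²)_∞`. -/
noncomputable def qW (q ν x : ℝ) : ℝ :=
  qPochInf (x ^ 2 * q ^ 2) (q ^ 2) / qPochInf (x ^ 2 * q ^ (2 * ν + 1)) (q ^ 2)

/-- The `q`-exponential `E(q, z) = ∏_{k=0}^∞ (1 + z q^k)`. -/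
noncomputable def qExpBig (q z : ℝ) : ℝ :=
  ∏' k : ℕ, (1 + z * q ^ k)

/-- The `q`-Jackson integral over `[-1,1]`:
`∫_{-1}^1 f(t) d_q t = (1-q) Σ_{n=0}^∞ q^n (f(q^n) + f(-q^n))`. -/
noncomputable def jacksonSym (q : ℝ) (f : ℝ → ℝ) : ℝ :=
  (1 - q) * ∑' n : ℕ, q ^ n * (f (q ^ n) + f (-(q ^ n)))

/-- The normalized `q`-Dunkl kernel
`Ẽ_ν(x; q²) = ∫_{-1}^1 W_ν(t;q²)(1+t) E(q,(1-q)tx) d_q t`. -/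
noncomputable def qDunklEt (q ν x : ℝ) : ℝ :=
  jacksonSym q (fun t => qW q ν t * (1 + t) * qExpBig q ((1 - q) * t * x))

theorem qg_summable {p : ℝ} (hp0 : 0 < p) (hp1 : p < 1) (x : ℝ) :
    Summable (fun n : ℕ => Real.log (1 - p ^ ((n : ℝ) + x))) := by
  have h : Summable (fun n : ℕ => -(p ^ ((n : ℝ) + x))) := by
    have : (fun n : ℕ => -(p ^ ((n : ℝ) + x))) = fun n : ℕ => p ^ n * (-(p ^ x)) := by
      funext n
      rw [Real.rpow_add hp0, Real.rpow_natCast]; ring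
    rw [this]
    exact (summable_geometric_of_lt_one hp0.le hp1).mul_right _
  simpa [sub_eq_add_neg] using Real.summable_log_one_add_of_summable h

theorem qg_pos {p : ℝ} (hp0 : 0 < p) (hp1 : p < 1) {x : ℝ} (hx : 0 < x) :
    0 < 1 - p ^ x := by
  have := Real.rpow_lt_one hp0.le hp1 hx
  linarith

theorem qg_log {p : ℝ} (hp0 : 0 < p) (hp1 : p < 1) {x : ℝ} (hx : 0 < x) :
    0 < qGamma p x ∧ Real.log (qGamma p x) = (1 - x) * Real.log (1 - p) +
      (∑' n : ℕ, Real.log (1 - p ^ ((n : ℝ) + 1)) - ∑' n : ℕ, Real.log (1 - p ^ ((n : ℝ) + x))) := by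
  have hpos : ∀ n : ℕ, 0 < 1 - p ^ ((n : ℝ) + x) := fun n => qg_pos hp0 hp1 (by positivity)
  have hpos1 : ∀ n : ℕ, 0 < 1 - p ^ ((n : ℝ) + 1) := fun n => qg_pos hp0 hp1 (by positivity)
  have e : (fun n : ℕ => Real.log ((1 - p ^ ((n : ℝ) + 1)) / (1 - p ^ ((n : ℝ) + x)))) =
      fun n : ℕ => Real.log (1 - p ^ ((n : ℝ) + 1)) - Real.log (1 - p ^ ((n : ℝ) + x)) := by
    funext n
    exact Real.log_div (hpos1 n).ne' (hpos n).ne'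
  have hs1 := qg_summable hp0 hp1 1
  have hs := qg_summable hp0 hp1 x
  have hS : Summable (fun n : ℕ =>
      Real.log ((1 - p ^ ((n : ℝ) + 1)) / (1 - p ^ ((n : ℝ) + x)))) := by
    rw [e]; exact hs1.sub hs
  have key := Real.rexp_tsum_eq_tprod (fun n => div_pos (hpos1 n) (hpos n)) hS
  have hq : qGamma p x = (1 - p) ^ (1 - x) *
      Real.exp (∑' n : ℕ, Real.log (1 - p ^ ((n : ℝ) + 1)) -
        ∑' n : ℕ, Real.log (1 - p ^ ((n : ℝ) + x))) := by
    rw [← hs1.tsum_sub hs, ← e, key]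
    unfold qGamma
    congr 1
    refine tprod_congr fun n => ?_
    rw [← Real.rpow_natCast p (n + 1)]
    push_cast
    rfl
  have h1 : 0 < 1 - p := by linarith
  have h2 := Real.rpow_pos_of_pos h1 (1 - x)
  rw [hq]
  refine ⟨mul_pos h2 (Real.exp_pos _), ?_⟩
  rw [Real.log_mul h2.ne' (Real.exp_pos _).ne', Real.log_exp, Real.log_rpow h1]

theorem qg_shift {p : ℝ} (hp0 : 0 < p) (hp1 : p < 1) {x : ℝ} (hx : 0 < x) :
    Real.log (qGamma p (x + 1)) =
      Real.log (qGamma p x) + Real.log (1 - p ^ x) - Real.log (1 - p) := by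
  rw [(qg_log hp0 hp1 hx).2, (qg_log hp0 hp1 (by linarith : 0 < x + 1)).2,
    (qg_summable hp0 hp1 x).tsum_eq_zero_add]
  have : ∀ n : ℕ, ((n + 1 : ℕ) : ℝ) + x = (n : ℝ) + (x + 1) := fun n => by push_cast; ring
  simp only [this, Nat.cast_zero, zero_add]
  ring

theorem qg_convex {p : ℝ} (hp0 : 0 < p) (hp1 : p < 1) {c : ℝ} (hc : 0 ≤ c) :
    ConvexOn ℝ (Set.Ioi (0 : ℝ)) (fun ν : ℝ => -Real.log (1 - p ^ (ν + c))) := by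
  refine ⟨convex_Ioi 0, ?_⟩
  intro x hx y hy a b ha hb hab
  simp only [Set.mem_Ioi, smul_eq_mul] at *
  have h1 := qg_pos hp0 hp1 (by linarith : 0 < x + c)
  have h2 := qg_pos hp0 hp1 (by linarith : 0 < y + c)
  have hL := strictConcaveOn_log_Ioi.concaveOn.2 (Set.mem_Ioi.2 h1) (Set.mem_Ioi.2 h2) ha hb hab
  simp only [smul_eq_mul] at hL
  have hE := convexOn_exp.2 (Set.mem_univ (Real.log p * (x + c)))
    (Set.mem_univ (Real.log p * (y + c))) ha hb hab
  simp only [smul_eq_mul, ← Real.rpow_def_of_pos hp0] at hE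
  have e : a * (Real.log p * (x + c)) + b * (Real.log p * (y + c)) =
      Real.log p * (a * x + b * y + c) := by
    linear_combination Real.log p * c * hab
  rw [e, ← Real.rpow_def_of_pos hp0] at hE
  have hm : 0 < a * (1 - p ^ (x + c)) + b * (1 - p ^ (y + c)) := by
    rcases ha.eq_or_lt with h | h
    · subst h
      have : b = 1 := by linarith
      subst this
      linarith
    · have := mul_pos h h1
      have := mul_nonneg hb h2.le
      linarith
  have := Real.log_le_log hm (by linarith :
    a * (1 - p ^ (x + c)) + b * (1 - p ^ (y + c)) ≤ 1 - p ^ (a * x + b * y + c))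
  linarith

theorem qg_main {p : ℝ} (hp0 : 0 < p) (hp1 : p < 1) (k : ℕ) :
    ConvexOn ℝ (Set.Ioi (0 : ℝ)) (fun ν : ℝ =>
      Real.log (qGamma p (ν + 1)) - Real.log (qGamma p (ν + k + 1))) := by
  induction k with
  | zero => simpa using convexOn_const (0 : ℝ) (convex_Ioi (0 : ℝ))
  | succ k ih =>
    have hk : (0 : ℝ) ≤ (k : ℝ) + 1 := by positivity
    refine ((ih.add (qg_convex hp0 hp1 hk)).add_const (Real.log (1 - p))).congr ?_
    intro ν hν
    have hν' : 0 < ν := hν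
    have := qg_shift hp0 hp1 (by positivity : 0 < ν + k + 1)
    have e : ν + ((k + 1 : ℕ) : ℝ) + 1 = ν + k + 1 + 1 := by push_cast; ring
    have e2 : ν + ((k : ℝ) + 1) = ν + k + 1 := by ring
    simp only [Pi.add_apply, e, e2, this]
    ring

/-- for fixed `q ∈ (0,1)` and `k ≥ 0`, the function
`ν ↦ Γ_{q²}(ν+1)/Γ_{q²}(ν+k+1)` is log-convex on `(0,∞)`,
i.e. its logarithm is convex on `(0,∞)`. -/
theorem qGamma_ratio_logConvex (q : ℝ) (hq : q ∈ Set.Ioo (0 : ℝ) 1) (k : ℕ) :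
    ConvexOn ℝ (Set.Ioi (0 : ℝ)) (fun ν : ℝ =>
      Real.log (qGamma (q ^ 2) (ν + 1) / qGamma (q ^ 2) (ν + k + 1))) := by
  have hp0 : 0 < q ^ 2 := pow_pos hq.1 2
  have hp1 : q ^ 2 < 1 := pow_lt_one₀ hq.1.le hq.2 two_ne_zero
  refine (qg_main hp0 hp1 k).congr ?_
  intro ν hν
  have hν' : 0 < ν := hν
  exact (Real.log_div (qg_log hp0 hp1 (by positivity : 0 < ν + 1)).1.ne'
    (qg_log hp0 hp1 (by positivity : 0 < ν + k + 1)).1.ne').symm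
end

section
/- Fix q ∈ (0,1) and x, λ ∈ [0, 1/(1−q)). The function ν ↦ E_ν(λx; q²) is log-convex on (0,∞): for all ν₁, ν₂ > 0 and all α ∈ [0,1], E_{αν₁+(1−α)ν₂}(λx; q²) ≤ [E_{ν₁}(λx; q²)]^α · [E_{ν₂}(λx; q²)]^{1−α}. -/
open Real

lemma qG_aux_lt {p y : ℝ} (hp : 0 < p) (hp1 : p < 1) (hy : 0 < y) : 0 < 1 - p ^ y := by
  have := Real.rpow_lt_one hp.le hp1 hy
  linarith

lemma qG_sum_log {p y : ℝ} (hp : 0 < p) (hp1 : p < 1) :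
    Summable (fun n : ℕ => Real.log (1 - p ^ ((n : ℝ) + y))) := by
  have h : Summable (fun n : ℕ => -p ^ ((n : ℝ) + y)) := by
    have h2 : (fun n : ℕ => -p ^ ((n : ℝ) + y)) = fun n : ℕ => p ^ n * (-p ^ y) := by
      funext n
      rw [Real.rpow_add hp, Real.rpow_natCast]; ring
    rw [h2]
    exact (summable_geometric_of_lt_one hp.le hp1).mul_right _
  have := Real.summable_log_one_add_of_summable h
  simpa [sub_eq_add_neg] using this

lemma qG_fac_pos {p y : ℝ} (hp : 0 < p) (hp1 : p < 1) (hy : 0 < y) (n : ℕ) :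
    0 < (1 - p ^ (n + 1)) / (1 - p ^ ((n : ℝ) + y)) := by
  have h1 : p ^ (n + 1) < 1 := pow_lt_one₀ hp.le hp1 (by omega)
  have h2 := qG_aux_lt hp hp1 (show (0 : ℝ) < n + y by positivity)
  exact div_pos (by linarith) h2

lemma qG_sum_log_fac {p y : ℝ} (hp : 0 < p) (hp1 : p < 1) (hy : 0 < y) :
    Summable (fun n : ℕ => Real.log ((1 - p ^ (n + 1)) / (1 - p ^ ((n : ℝ) + y)))) := by
  have h := (qG_sum_log (y := 1) hp hp1).sub (qG_sum_log (y := y) hp hp1)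
  refine h.congr ?_
  intro n
  have h1 := qG_aux_lt hp hp1 (show (0 : ℝ) < n + 1 by positivity)
  have h2 := qG_aux_lt hp hp1 (show (0 : ℝ) < n + y by positivity)
  have h3 : p ^ ((n : ℝ) + 1) = p ^ (n + 1) := by
    rw [← Real.rpow_natCast]; push_cast; rfl
  rw [← h3, Real.log_div h1.ne' h2.ne']

lemma qGamma_pos {p y : ℝ} (hp : 0 < p) (hp1 : p < 1) (hy : 0 < y) : 0 < qGamma p y := by
  unfold qGamma
  rw [← Real.rexp_tsum_eq_tprod (qG_fac_pos hp hp1 hy) (qG_sum_log_fac hp hp1 hy)]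
  have : 0 < (1 - p) ^ (1 - y) := Real.rpow_pos_of_pos (by linarith) _
  positivity

open Filter Topology in
lemma qGamma_succ {p y : ℝ} (hp : 0 < p) (hp1 : p < 1) (hy : 0 < y) :
    qGamma p (y + 1) = (1 - p ^ y) / (1 - p) * qGamma p y := by
  have hy1 : 0 < y + 1 := by linarith
  have m1 := (Real.multipliable_of_summable_log (qG_fac_pos hp hp1 hy)
    (qG_sum_log_fac hp hp1 hy)).hasProd.tendsto_prod_nat
  have m2 := (Real.multipliable_of_summable_log (qG_fac_pos hp hp1 hy1)
    (qG_sum_log_fac hp hp1 hy1)).hasProd.tendsto_prod_nat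
  have key : ∀ N : ℕ, ∏ n ∈ Finset.range N, (1 - p ^ (n + 1)) / (1 - p ^ ((n : ℝ) + (y + 1)))
      = (∏ n ∈ Finset.range N, (1 - p ^ (n + 1)) / (1 - p ^ ((n : ℝ) + y)))
        * ((1 - p ^ y) / (1 - p ^ ((N : ℝ) + y))) := by
    intro N
    induction N with
    | zero =>
      have := (qG_aux_lt hp hp1 hy).ne'
      simp [this]
    | succ N ih =>
      rw [Finset.prod_range_succ, Finset.prod_range_succ, ih]
      have e : ((N + 1 : ℕ) : ℝ) + y = (N : ℝ) + (y + 1) := by push_cast; ring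
      rw [e]
      have h1 := (qG_aux_lt hp hp1 (show (0 : ℝ) < N + y by positivity)).ne'
      have h2 := (qG_aux_lt hp hp1 (show (0 : ℝ) < N + (y + 1) by positivity)).ne'
      field_simp
  have lim : Tendsto (fun N : ℕ => (1 - p ^ y) / (1 - p ^ ((N : ℝ) + y))) atTop
      (𝓝 ((1 - p ^ y) / (1 - 0 * p ^ y))) := by
    have h0 : Tendsto (fun N : ℕ => p ^ N * p ^ y) atTop (𝓝 (0 * p ^ y)) :=
      (tendsto_pow_atTop_nhds_zero_of_lt_one hp.le hp1).mul_const _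
    have h1 : (fun N : ℕ => (1 - p ^ y) / (1 - p ^ ((N : ℝ) + y)))
        = fun N : ℕ => (1 - p ^ y) / (1 - p ^ N * p ^ y) := by
      funext N; rw [Real.rpow_add hp, Real.rpow_natCast]
    rw [h1]
    exact (tendsto_const_nhds).div (tendsto_const_nhds.sub h0) (by simp)
  have m3 := m1.mul lim
  have := tendsto_nhds_unique m2 (m3.congr (fun N => (key N).symm))
  unfold qGamma
  rw [this]
  have h1p : 0 < 1 - p := by linarith
  have e : (1 - p) ^ (1 - (y + 1)) = (1 - p) ^ (1 - y) / (1 - p) := by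
    rw [show 1 - (y + 1) = (1 - y) - 1 by ring, Real.rpow_sub_one h1p.ne']
  rw [e]
  simp only [zero_mul, sub_zero, div_one]
  ring

lemma qGamma_ratio {p ν : ℝ} (hp : 0 < p) (hp1 : p < 1) (hν : 0 < ν) (k : ℕ) :
    qGamma p (ν + k + 1) = (∏ j ∈ Finset.range k, (1 - p ^ (ν + j + 1))) / (1 - p) ^ k
      * qGamma p (ν + 1) := by
  have h1p : 1 - p ≠ 0 := by linarith
  induction k with
  | zero => simp
  | succ k ih =>
    have := qGamma_succ hp hp1 (show 0 < ν + k + 1 by positivity)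
    rw [show ν + ((k + 1 : ℕ) : ℝ) + 1 = ν + k + 1 + 1 by push_cast; ring, this, ih,
      Finset.prod_range_succ, pow_succ]
    field_simp

/-- product part -/
noncomputable def qA (p : ℝ) (k : ℕ) (ν : ℝ) : ℝ :=
  ∏ j ∈ Finset.range k, (1 - p ^ (ν + j + 1))⁻¹

lemma qA_one_le {p ν : ℝ} (hp : 0 < p) (hp1 : p < 1) (hν : 0 < ν) (k : ℕ) : 1 ≤ qA p k ν := by
  unfold qA
  have : ∀ j ∈ Finset.range k, (1:ℝ) ≤ (1 - p ^ (ν + j + 1))⁻¹ := by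
    intro j _
    have h1 := qG_aux_lt hp hp1 (show (0 : ℝ) < ν + j + 1 by positivity)
    apply (one_le_inv₀ h1).2
    have : 0 < p ^ (ν + j + 1) := Real.rpow_pos_of_pos hp _
    linarith
  calc (1:ℝ) = ∏ j ∈ Finset.range k, 1 := by simp
    _ ≤ _ := Finset.prod_le_prod (fun _ _ => zero_le_one) this

lemma qA_le {p ν : ℝ} (hp : 0 < p) (hp1 : p < 1) (hν : 0 < ν) (k : ℕ) :
    qA p k ν ≤ Real.exp ((1 - p)⁻¹ * (1 - p)⁻¹) := by
  have h1p : 0 < 1 - p := by linarith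
  have : ∀ j ∈ Finset.range k, (1 - p ^ (ν + j + 1))⁻¹ ≤ Real.exp (p ^ j * (1 - p)⁻¹) := by
    intro j _
    have h1 := qG_aux_lt hp hp1 (show (0 : ℝ) < ν + j + 1 by positivity)
    have ha : p ^ (ν + j + 1) ≤ p ^ j := by
      rw [← Real.rpow_natCast]
      exact Real.rpow_le_rpow_of_exponent_ge hp hp1.le (by linarith)
    have hb : p ^ (ν + j + 1) ≤ p := by
      conv_rhs => rw [← Real.rpow_one p]
      exact Real.rpow_le_rpow_of_exponent_ge hp hp1.le (by
        have : (0:ℝ) ≤ j := by positivity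
        linarith)
    have hc : 0 < p ^ (ν + j + 1) := Real.rpow_pos_of_pos hp _
    refine le_trans ?_ (Real.add_one_le_exp _)
    have : (1 - p ^ (ν + j + 1))⁻¹ = p ^ (ν + j + 1) * (1 - p ^ (ν + j + 1))⁻¹ + 1 := by
      field_simp; ring
    rw [this]
    gcongr
  unfold qA
  calc _ ≤ ∏ j ∈ Finset.range k, Real.exp (p ^ j * (1 - p)⁻¹) := by
        refine Finset.prod_le_prod (fun j _ => ?_) this
        have h1 := qG_aux_lt hp hp1 (show (0 : ℝ) < ν + j + 1 by positivity)
        positivity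
    _ = Real.exp (∑ j ∈ Finset.range k, p ^ j * (1 - p)⁻¹) := (Real.exp_sum _ _).symm
    _ ≤ _ := by
        have hg : ∑ j ∈ Finset.range k, p ^ j ≤ (1 - p)⁻¹ := by
          rw [← tsum_geometric_of_lt_one hp.le hp1]
          exact (summable_geometric_of_lt_one hp.le hp1).sum_le_tsum _ (fun i _ => by positivity)
        rw [← Finset.sum_mul]
        exact Real.exp_le_exp.2 (mul_le_mul_of_nonneg_right hg (inv_pos.2 h1p).le)

lemma qA_logconv {p ν₁ ν₂ α : ℝ} (hp : 0 < p) (hp1 : p < 1) (h₁ : 0 < ν₁) (h₂ : 0 < ν₂)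
    (hα : 0 ≤ α) (hα1 : α ≤ 1) (k : ℕ) (hν : 0 < α * ν₁ + (1 - α) * ν₂) :
    qA p k (α * ν₁ + (1 - α) * ν₂) ≤ qA p k ν₁ ^ α * qA p k ν₂ ^ (1 - α) := by
  have hb : 0 ≤ 1 - α := by linarith
  have pos : ∀ ν : ℝ, 0 < ν → ∀ j : ℕ, 0 < 1 - p ^ (ν + j + 1) := fun ν h j =>
    qG_aux_lt hp hp1 (by positivity)
  unfold qA
  rw [← Real.finsetProd_rpow _ _ (fun j _ => (inv_pos.2 (pos _ h₁ j)).le),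
    ← Real.finsetProd_rpow _ _ (fun j _ => (inv_pos.2 (pos _ h₂ j)).le),
    ← Finset.prod_mul_distrib]
  refine Finset.prod_le_prod (fun j _ => (inv_pos.2 (pos _ hν j)).le) (fun j _ => ?_)
  rw [Real.inv_rpow (pos _ h₁ j).le, Real.inv_rpow (pos _ h₂ j).le, ← mul_inv]
  have c1 := Real.rpow_pos_of_pos (pos _ h₁ j) α
  have c2 := Real.rpow_pos_of_pos (pos _ h₂ j) (1 - α)
  refine inv_anti₀ (by positivity) ?_
  have a1 : 0 < p ^ (ν₁ + j + 1) := Real.rpow_pos_of_pos hp _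
  have a2 : 0 < p ^ (ν₂ + j + 1) := Real.rpow_pos_of_pos hp _
  have e : p ^ (α * ν₁ + (1 - α) * ν₂ + j + 1)
      = (p ^ (ν₁ + j + 1)) ^ α * (p ^ (ν₂ + j + 1)) ^ (1 - α) := by
    rw [← Real.rpow_mul hp.le, ← Real.rpow_mul hp.le, ← Real.rpow_add hp]
    congr 1; ring
  have g1 := Real.geom_mean_le_arith_mean2_weighted hα hb a1.le a2.le (by ring)
  have g2 := Real.geom_mean_le_arith_mean2_weighted hα hb (pos _ h₁ j).le (pos _ h₂ j).le (by ring)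
  rw [e]
  linarith

lemma qTerm (q : ℝ) (hq : 0 < q) (hq1 : q < 1) (z : ℝ) (hz : 0 ≤ z) (n : ℕ) :
    ∃ c : ℝ, ∃ k : ℕ, 0 ≤ c ∧ (n = 0 → 0 < c) ∧
      ∀ ν : ℝ, 0 < ν → z ^ n / qDunklB q n ν = c * qA (q ^ 2) k ν := by
  have hp : 0 < q ^ 2 := by positivity
  have hp1 : q ^ 2 < 1 := pow_lt_one₀ hq.le hq1 (by norm_num)
  have h1p : 0 < 1 - q ^ 2 := by linarith
  have hG := qGamma_pos hp hp1 (show (0:ℝ) < ((n / 2 : ℕ) : ℝ) + 1 by positivity)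
  have gen : ∀ (m k : ℕ) (ν : ℝ), 0 < ν →
      z ^ n / ((1 + q) ^ m * qGamma (q ^ 2) ((n / 2 : ℕ) + 1) *
      qGamma (q ^ 2) (ν + k + 1) / qGamma (q ^ 2) (ν + 1)) =
      (z ^ n / ((1 + q) ^ m * qGamma (q ^ 2) ((n / 2 : ℕ) + 1)) * (1 - q ^ 2) ^ k)
        * qA (q ^ 2) k ν := by
    intro m k ν hν
    have hν1 := (qGamma_pos hp hp1 (show (0:ℝ) < ν + 1 by positivity)).ne'
    rw [qGamma_ratio hp hp1 hν, qA, Finset.prod_inv_distrib]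
    have : ∏ j ∈ Finset.range k, (1 - (q ^ 2) ^ (ν + j + 1)) ≠ 0 :=
      Finset.prod_ne_zero_iff.2 fun j _ => (qG_aux_lt hp hp1 (by positivity)).ne'
    have := hG.ne'
    generalize qGamma (q ^ 2) (((n / 2 : ℕ) : ℝ) + 1) = G at *
    generalize ∏ j ∈ Finset.range k, (1 - (q ^ 2) ^ (ν + j + 1)) = P at *
    generalize 1 - q ^ 2 = r at *
    field_simp
  by_cases he : Even n
  · refine ⟨z ^ n / ((1 + q) ^ (n / 2) * qGamma (q ^ 2) ((n / 2 : ℕ) + 1)) * (1 - q ^ 2) ^ (n / 2),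
      n / 2, ?_, ?_, fun ν hν => ?_⟩
    rotate_left 2
    · rw [qDunklB, if_pos he]; exact gen (n / 2) (n / 2) ν hν
    · positivity
    · rintro rfl; positivity
  · refine ⟨z ^ n / ((1 + q) ^ n * qGamma (q ^ 2) ((n / 2 : ℕ) + 1)) * (1 - q ^ 2) ^ (n / 2 + 1),
      n / 2 + 1, ?_, ?_, fun ν hν => ?_⟩
    rotate_left 2
    · rw [qDunklB, if_neg he, ← gen n (n / 2 + 1) ν hν]
      rw [show ν + ((n / 2 + 1 : ℕ) : ℝ) + 1 = ν + ((n / 2 : ℕ) : ℝ) + 2 by push_cast; ring]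
    · positivity
    · rintro rfl; simp at he

/-- log-convexity of `ν ↦ E_ν(λx; q²)` on `(0,∞)`. -/
theorem qDunklE_logConvex (q x lam : ℝ) (hq : q ∈ Set.Ioo (0 : ℝ) 1)
    (hx : x ∈ Set.Ico (0 : ℝ) (1 / (1 - q))) (hlam : lam ∈ Set.Ico (0 : ℝ) (1 / (1 - q))) :
    ∀ ν₁ ν₂ α : ℝ, 0 < ν₁ → 0 < ν₂ → α ∈ Set.Icc (0 : ℝ) 1 →
      qDunklE q (α * ν₁ + (1 - α) * ν₂) (lam * x) ≤
        qDunklE q ν₁ (lam * x) ^ α * qDunklE q ν₂ (lam * x) ^ (1 - α) := by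
  intro ν₁ ν₂ α h₁ h₂ hα
  obtain ⟨hα0, hα1⟩ := hα
  obtain ⟨hq0, hq1⟩ := hq
  have hz : 0 ≤ lam * x := mul_nonneg hlam.1 hx.1
  have hp : 0 < q ^ 2 := by positivity
  have hp1 : q ^ 2 < 1 := pow_lt_one₀ hq0.le hq1 (by norm_num)
  have hν : 0 < α * ν₁ + (1 - α) * ν₂ := by
    rcases hα0.eq_or_lt with h | h
    · subst h; simpa using h₂
    · have : 0 ≤ 1 - α := by linarith
      positivity
  choose c k hc hc0 hT using qTerm q hq0 hq1 (lam * x) hz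
  have hE : ∀ ν, 0 < ν → qDunklE q ν (lam * x) = ∑' n, c n * qA (q ^ 2) (k n) ν :=
    fun ν h => tsum_congr fun n => hT n ν h
  rw [hE _ hν, hE _ h₁, hE _ h₂]
  have hA : ∀ n ν, 0 < ν → 0 < qA (q ^ 2) (k n) ν := fun n ν h =>
    lt_of_lt_of_le one_pos (qA_one_le hp hp1 h _)
  have hnn : ∀ n ν, 0 < ν → 0 ≤ c n * qA (q ^ 2) (k n) ν := fun n ν h =>
    mul_nonneg (hc n) (hA n ν h).le
  by_cases hs : Summable fun n => c n * qA (q ^ 2) (k n) (α * ν₁ + (1 - α) * ν₂)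
  swap
  · rw [tsum_eq_zero_of_not_summable hs]
    exact mul_nonneg (Real.rpow_nonneg (tsum_nonneg fun n => hnn n _ h₁) _)
      (Real.rpow_nonneg (tsum_nonneg fun n => hnn n _ h₂) _)
  have hcs : Summable c := Summable.of_nonneg_of_le hc
    (fun n => le_mul_of_one_le_right (hc n) (qA_one_le hp hp1 hν _)) hs
  have hsum : ∀ ν, 0 < ν → Summable fun n => c n * qA (q ^ 2) (k n) ν := fun ν h =>
    Summable.of_nonneg_of_le (fun n => hnn n ν h)
      (fun n => mul_le_mul_of_nonneg_left (qA_le hp hp1 h _) (hc n)) (hcs.mul_right _)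
  have hpos : ∀ ν, 0 < ν → 0 < ∑' n, c n * qA (q ^ 2) (k n) ν := fun ν h =>
    (hsum ν h).tsum_pos (fun n => hnn n ν h) 0 (mul_pos (hc0 0 rfl) (hA 0 ν h))
  have hU := hpos _ h₁
  have hV := hpos _ h₂
  have sU := (hsum _ h₁).hasSum
  have sV := (hsum _ h₂).hasSum
  generalize (∑' n, c n * qA (q ^ 2) (k n) ν₁) = U at *
  generalize (∑' n, c n * qA (q ^ 2) (k n) ν₂) = V at *
  have hb : 0 ≤ 1 - α := by linarith
  have hW : 0 < U ^ α * V ^ (1 - α) :=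
    mul_pos (Real.rpow_pos_of_pos hU _) (Real.rpow_pos_of_pos hV _)
  have sR := (((sU.div_const U).mul_left α).add ((sV.div_const V).mul_left (1 - α))).mul_left
    (U ^ α * V ^ (1 - α))
  rw [div_self hU.ne', div_self hV.ne', show α * 1 + (1 - α) * 1 = 1 by ring, mul_one] at sR
  refine hasSum_le (fun n => ?_) hs.hasSum sR
  have g := Real.geom_mean_le_arith_mean2_weighted hα0 hb (div_nonneg (hnn n _ h₁) hU.le)
    (div_nonneg (hnn n _ h₂) hV.le) (by ring)
  refine le_trans ?_ (mul_le_mul_of_nonneg_left g hW.le)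
  rw [Real.div_rpow (hnn n _ h₁) hU.le, Real.div_rpow (hnn n _ h₂) hV.le]
  have e1 := (Real.rpow_pos_of_pos hU α).ne'
  have e2 := (Real.rpow_pos_of_pos hV (1 - α)).ne'
  have e3 : U ^ α * V ^ (1 - α) * ((c n * qA (q ^ 2) (k n) ν₁) ^ α / U ^ α *
      ((c n * qA (q ^ 2) (k n) ν₂) ^ (1 - α) / V ^ (1 - α))) =
      (c n * qA (q ^ 2) (k n) ν₁) ^ α * (c n * qA (q ^ 2) (k n) ν₂) ^ (1 - α) := by
    field_simp
  rw [e3, Real.mul_rpow (hc n) (hA n _ h₁).le, Real.mul_rpow (hc n) (hA n _ h₂).le]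
  have e4 : c n ^ α * c n ^ (1 - α) = c n := by
    rw [← Real.rpow_add_of_nonneg (hc n) hα0 hb]; simp
  calc _ ≤ c n * (qA (q ^ 2) (k n) ν₁ ^ α * qA (q ^ 2) (k n) ν₂ ^ (1 - α)) :=
        mul_le_mul_of_nonneg_left (qA_logconv hp hp1 h₁ h₂ hα0 hα1 _ hν) (hc n)
    _ = (c n ^ α * c n ^ (1 - α)) * (qA (q ^ 2) (k n) ν₁ ^ α * qA (q ^ 2) (k n) ν₂ ^ (1 - α)) := by
        rw [e4]
    _ = _ := by ring
end

section
/- Fix q ∈ (0,1) and x, λ ∈ [0, 1/(1−q)). For every ν > 0, the Turán type inequality [E_{ν+1}(λx; q²)]² ≤ E_ν(λx; q²) · E_{ν+2}(λx; q²) holds. -/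
open Real

lemma aux_cs (a b c : ℕ → ℝ) (ha : ∀ n, 0 ≤ a n) (hc : ∀ n, 0 ≤ c n)
    (h : ∀ n, b n ^ 2 ≤ a n * c n) (sa : Summable a) (sb : Summable b) (sc : Summable c) :
    (∑' n, b n) ^ 2 ≤ (∑' n, a n) * ∑' n, c n := by
  have key : ∀ t : ℝ, 0 ≤ (∑' n, a n) * (t * t) + (-2 * ∑' n, b n) * t + ∑' n, c n := by
    intro t
    have hs := ((sa.hasSum.mul_right (t * t)).add
      ((sb.hasSum.mul_left (-2)).mul_right t)).add sc.hasSum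
    rw [← hs.tsum_eq]
    refine tsum_nonneg fun n => ?_
    have h1 := ha n
    have h2 := hc n
    have h3 := h n
    rcases h1.eq_or_lt with h0 | h0
    · rw [← h0] at h3 ⊢
      have : b n = 0 := by
        have : b n ^ 2 ≤ 0 := by simpa using h3
        exact pow_eq_zero_iff (two_ne_zero) |>.1 (le_antisymm this (sq_nonneg _))
      rw [this]; simpa using h2
    · refine nonneg_of_mul_nonneg_right (a := a n) ?_ h0
      nlinarith [sq_nonneg (a n * t - b n)]
  have := discrim_le_zero key
  unfold discrim at this
  nlinarith

lemma aux_den {p y : ℝ} (hp : p ∈ Set.Ioo (0 : ℝ) 1) (hy : 0 < y) : 0 < 1 - p ^ y :=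
  sub_pos.2 (Real.rpow_lt_one hp.1.le hp.2 hy)

lemma aux_tendsto {p y : ℝ} (hp : p ∈ Set.Ioo (0 : ℝ) 1) (hy : 0 < y) :
    Filter.Tendsto (fun N => ∏ n ∈ Finset.range N,
      ((1 - p ^ (n + 1)) / (1 - p ^ ((n : ℝ) + y)))) Filter.atTop
      (nhds (∏' n : ℕ, (1 - p ^ (n + 1)) / (1 - p ^ ((n : ℝ) + y)))) := by
  apply Multipliable.tendsto_prod_tprod_nat
  have hpp := hp.1
  have e : ∀ n : ℕ, p ^ ((n : ℝ) + y) = p ^ n * p ^ y := fun n => by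
    rw [Real.rpow_add hp.1, Real.rpow_natCast]
  have hd : ∀ n : ℕ, 0 < 1 - p ^ ((n : ℝ) + y) := fun n => aux_den hp (by positivity)
  have : (fun n : ℕ => (1 - p ^ (n + 1)) / (1 - p ^ ((n : ℝ) + y)))
      = fun n : ℕ => 1 + (p ^ ((n : ℝ) + y) - p ^ (n + 1)) / (1 - p ^ ((n : ℝ) + y)) := by
    funext n
    have := (hd n).ne'
    field_simp
    ring
  rw [this]
  apply Real.multipliable_one_add_of_summable
  have hg : Summable (fun n : ℕ => p ^ n * (|p ^ y - p| / (1 - p ^ y))) :=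
    (summable_geometric_of_lt_one hp.1.le hp.2).mul_right _
  refine Summable.of_norm_bounded hg fun n => ?_
  rw [norm_div, Real.norm_eq_abs, Real.norm_eq_abs, abs_of_pos (hd n), e, pow_succ, ← mul_sub,
    abs_mul, abs_of_pos (pow_pos hp.1 n), mul_div_assoc]
  have h1 := aux_den hp hy
  have h2 : p ^ n * p ^ y ≤ p ^ y :=
    mul_le_of_le_one_left (Real.rpow_pos_of_pos hp.1 _).le (pow_le_one₀ hp.1.le hp.2.le)
  gcongr

lemma aux_nonneg {p y : ℝ} (hp : p ∈ Set.Ioo (0 : ℝ) 1) (hy : 0 < y) : 0 ≤ qGamma p y := by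
  unfold qGamma
  refine mul_nonneg (Real.rpow_nonneg (sub_nonneg.2 hp.2.le) _) ?_
  refine ge_of_tendsto' (aux_tendsto hp hy) fun N => Finset.prod_nonneg fun n _ => ?_
  exact div_nonneg (sub_nonneg.2 (pow_le_one₀ hp.1.le hp.2.le))
    (aux_den hp (by positivity)).le

lemma aux_rec {p y : ℝ} (hp : p ∈ Set.Ioo (0 : ℝ) 1) (hy : 0 < y) :
    qGamma p (y + 1) = (1 - p ^ y) / (1 - p) * qGamma p y := by
  have h1 := aux_tendsto hp hy
  have h2 := aux_tendsto hp (y := y + 1) (by linarith)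
  have hd : ∀ n : ℕ, 0 < 1 - p ^ ((n : ℝ) + y) := fun n => aux_den hp (by positivity)
  have h3 : ∀ N : ℕ, ∏ n ∈ Finset.range N, ((1 - p ^ (n + 1)) / (1 - p ^ ((n : ℝ) + (y + 1))))
      = (∏ n ∈ Finset.range N, ((1 - p ^ (n + 1)) / (1 - p ^ ((n : ℝ) + y)))) *
        ((1 - p ^ y) / (1 - p ^ N * p ^ y)) := by
    intro N
    have e : p ^ N * p ^ y = p ^ ((N : ℝ) + y) := by
      rw [Real.rpow_add hp.1, Real.rpow_natCast]
    rw [e]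
    clear e
    induction N with
    | zero => simp [(aux_den hp hy).ne']
    | succ N ih =>
      rw [Finset.prod_range_succ, Finset.prod_range_succ, ih]
      have a1 := (hd N).ne'
      have a2 := (hd (N + 1)).ne'
      have e2 : (N : ℝ) + (y + 1) = ((N + 1 : ℕ) : ℝ) + y := by push_cast; ring
      rw [e2]
      field_simp
  have h4 : Filter.Tendsto (fun N : ℕ => (1 - p ^ y) / (1 - p ^ N * p ^ y)) Filter.atTop
      (nhds ((1 - p ^ y) / (1 - 0 * p ^ y))) := by
    refine Filter.Tendsto.div tendsto_const_nhds (tendsto_const_nhds.sub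
      ((tendsto_pow_atTop_nhds_zero_of_lt_one hp.1.le hp.2).mul_const _)) (by simp)
  have h5 := tendsto_nhds_unique (h2.congr h3) (h1.mul h4)
  unfold qGamma
  rw [h5]
  have h6 : 0 < 1 - p := sub_pos.2 hp.2
  have : (1 - p) ^ (1 - y) = (1 - p) ^ (1 - (y + 1)) * (1 - p) := by
    conv_rhs => rw [← Real.rpow_one (1 - p), ← Real.rpow_mul h6.le, ← Real.rpow_add h6]
    congr 1
    ring
  rw [this]
  field_simp
  simp

/-- number of factors -/
def auxM (n : ℕ) : ℕ := if Even n then n / 2 else n / 2 + 1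

lemma auxB_eq (q ν : ℝ) (n : ℕ) : ∃ K : ℝ, (0 < q → K = (1 + q) ^ (if Even n then n / 2 else n)) ∧
    ∀ ν, qDunklB q n ν = K * qGamma (q ^ 2) ((n / 2 : ℕ) + 1) *
      qGamma (q ^ 2) (ν + 1 + auxM n) / qGamma (q ^ 2) (ν + 1) := by
  refine ⟨_, fun _ => rfl, fun ν => ?_⟩
  unfold qDunklB auxM
  split_ifs
  · congr 3; ring
  · congr 3; push_cast; ring

lemma auxB_nonneg {q ν : ℝ} (hq : q ∈ Set.Ioo (0 : ℝ) 1) (hν : 0 < ν) (n : ℕ) :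
    0 ≤ qDunklB q n ν := by
  have hp : q ^ 2 ∈ Set.Ioo (0 : ℝ) 1 := ⟨pow_pos hq.1 2, pow_lt_one₀ hq.1.le hq.2 two_ne_zero⟩
  obtain ⟨K, hK, h⟩ := auxB_eq q ν n
  have hK := hK hq.1
  have hK0 : 0 ≤ K := by
    rw [hK]; have := hq.1; positivity
  rw [h]
  exact div_nonneg (mul_nonneg (mul_nonneg hK0 (aux_nonneg hp (by positivity)))
    (aux_nonneg hp (by positivity))) (aux_nonneg hp (by positivity))

lemma auxB_rec {q ν : ℝ} (hq : q ∈ Set.Ioo (0 : ℝ) 1) (hν : 0 < ν) (n : ℕ) :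
    qDunklB q n (ν + 1) = qDunklB q n ν *
      ((1 - (q ^ 2) ^ (ν + 1) * (q ^ 2) ^ auxM n) / (1 - (q ^ 2) ^ (ν + 1))) := by
  have hp : q ^ 2 ∈ Set.Ioo (0 : ℝ) 1 := ⟨pow_pos hq.1 2, pow_lt_one₀ hq.1.le hq.2 two_ne_zero⟩
  obtain ⟨K, -, h⟩ := auxB_eq q ν n
  rw [h, h]
  rw [show ν + 1 + 1 + (auxM n : ℝ) = (ν + 1 + auxM n) + 1 by ring,
    aux_rec hp (y := ν + 1 + auxM n) (by positivity), aux_rec hp (y := ν + 1) (by positivity),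
    Real.rpow_add hp.1 (ν + 1), Real.rpow_natCast]
  have h1 := (aux_den hp (y := ν + 1) (by positivity)).ne'
  have h2 := (sub_pos.2 hp.2).ne'
  rcases eq_or_ne (qGamma (q ^ 2) (ν + 1)) 0 with h0 | h0
  · simp [h0]
  · field_simp

/-- Turán type inequality for the `q`-Dunkl kernel. -/
theorem qDunklE_turan (q x lam ν : ℝ) (hq : q ∈ Set.Ioo (0 : ℝ) 1)
    (hx : x ∈ Set.Ico (0 : ℝ) (1 / (1 - q))) (hlam : lam ∈ Set.Ico (0 : ℝ) (1 / (1 - q)))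
    (hν : 0 < ν) :
    qDunklE q (ν + 1) (lam * x) ^ 2 ≤ qDunklE q ν (lam * x) * qDunklE q (ν + 2) (lam * x) := by
  have hz : 0 ≤ lam * x := mul_nonneg hlam.1 hx.1
  generalize lam * x = z at hz
  have hp : q ^ 2 ∈ Set.Ioo (0 : ℝ) 1 := ⟨pow_pos hq.1 2, pow_lt_one₀ hq.1.le hq.2 two_ne_zero⟩
  have nn : ∀ μ : ℝ, 0 < μ → ∀ n, 0 ≤ z ^ n / qDunklB q n μ := fun μ hμ n =>
    div_nonneg (pow_nonneg hz n) (auxB_nonneg hq hμ n)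
  -- ratio
  let R : ℝ → ℕ → ℝ := fun μ n =>
    (1 - (q ^ 2) ^ (μ + 1) * (q ^ 2) ^ auxM n) / (1 - (q ^ 2) ^ (μ + 1))
  have hs : ∀ n, (q ^ 2) ^ auxM n ≤ 1 := fun n => pow_le_one₀ hp.1.le hp.2.le
  have hs0 : ∀ n, 0 < (q ^ 2) ^ auxM n := fun n => pow_pos hp.1 _
  have R1 : ∀ μ : ℝ, 0 < μ → ∀ n, 1 ≤ R μ n := fun μ hμ n => by
    have h1 := aux_den hp (y := μ + 1) (by positivity)
    have h2 : 0 < (q ^ 2) ^ (μ + 1) := Real.rpow_pos_of_pos hp.1 _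
    simp only [R]
    rw [le_div_iff₀ h1]
    nlinarith [hs n]
  have R2 : ∀ μ : ℝ, 0 < μ → ∀ n, R μ n ≤ 1 / (1 - (q ^ 2) ^ (μ + 1)) := fun μ hμ n => by
    have h1 := aux_den hp (y := μ + 1) (by positivity)
    have h2 : 0 < (q ^ 2) ^ (μ + 1) := Real.rpow_pos_of_pos hp.1 _
    simp only [R]
    rw [div_le_div_iff_of_pos_right h1]
    nlinarith [mul_pos h2 (hs0 n)]
  have R3 : ∀ n, R (ν + 1) n ≤ R ν n := fun n => by
    have h1 := aux_den hp (y := ν + 1) (by positivity)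
    have h1' := aux_den hp (y := ν + 1 + 1) (by positivity)
    have h2 : (q ^ 2) ^ (ν + 1 + 1) ≤ (q ^ 2) ^ (ν + 1) :=
      Real.rpow_le_rpow_of_exponent_ge hp.1 hp.2.le (by linarith)
    simp only [R]
    rw [div_le_div_iff₀ h1' h1]
    nlinarith [mul_nonneg (sub_nonneg.2 h2) (sub_nonneg.2 (hs n))]
  have C : ∀ μ : ℝ, 0 < μ → ∀ n,
      z ^ n / qDunklB q n μ = R μ n * (z ^ n / qDunklB q n (μ + 1)) := fun μ hμ n => by
    have h1 : R μ n ≠ 0 := by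
      exact (lt_of_lt_of_le one_pos (R1 μ hμ n)).ne'
    rw [auxB_rec hq hμ n]
    change _ = R μ n * (z ^ n / (qDunklB q n μ * R μ n))
    rcases eq_or_ne (qDunklB q n μ) 0 with h0 | h0
    · simp [h0]
    · field_simp
  have e2 : ν + 2 = ν + 1 + 1 := by ring
  have hν1 : 0 < ν + 1 := by linarith
  have hν2 : 0 < ν + 1 + 1 := by linarith
  rw [e2]
  unfold qDunklE
  by_cases sb : Summable (fun n => z ^ n / qDunklB q n (ν + 1))
  · refine aux_cs _ _ _ (nn ν hν) (nn _ hν2) (fun n => ?_) ?_ sb ?_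
    · rw [C ν hν n, C (ν + 1) hν1 n]
      have h0 := nn _ hν2 n
      have h1 := R1 (ν + 1) hν1 n
      have h3 := R3 n
      generalize z ^ n / qDunklB q n (ν + 1 + 1) = w at *
      have : 0 ≤ (R ν n - R (ν + 1) n) * (R (ν + 1) n * w ^ 2) :=
        mul_nonneg (sub_nonneg.2 h3) (mul_nonneg (by linarith) (sq_nonneg w))
      nlinarith
    · refine Summable.of_nonneg_of_le (nn ν hν) (fun n => ?_)
        (sb.mul_left (1 / (1 - (q ^ 2) ^ (ν + 1))))
      rw [C ν hν n]
      exact mul_le_mul_of_nonneg_right (R2 ν hν n) (nn _ hν1 n)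
    · refine Summable.of_nonneg_of_le (nn _ hν2) (fun n => ?_) sb
      rw [C _ hν1 n]
      exact le_mul_of_one_le_left (nn _ hν2 n) (R1 _ hν1 n)
  · rw [tsum_eq_zero_of_not_summable sb]
    rw [zero_pow two_ne_zero]
    exact mul_nonneg (tsum_nonneg (nn ν hν)) (tsum_nonneg (nn _ hν2))
end

section
/- For every real x < 0, the inequality (1 + x) e^{−x} ≤ sinh(x)/x holds. -/
/-- `(1 + x) e^{-x} ≤ sinh x / x` for `x < 0`. -/
theorem one_add_mul_exp_neg_le_sinh_div (x : ℝ) (hx : x < 0) :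
    (1 + x) * Real.exp (-x) ≤ Real.sinh x / x := by
  have h1 : (1 + x) * Real.exp (-x) ≤ 1 := by
    have h := Real.add_one_le_exp x
    have h2 : Real.exp x * Real.exp (-x) = 1 := by
      rw [← Real.exp_add]; simp
    nlinarith [Real.exp_pos (-x)]
  have h3 : 1 ≤ Real.sinh x / x := by
    rw [le_div_iff_of_neg hx, one_mul]
    exact Real.sinh_le_self_iff.2 hx.le
  exact h1.trans h3
end
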